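/- Let f(x) = x^6 + a x + b ∈ ℤ[x] be irreducible with 3 | a and 3 ∤ b, and let θ be a root. Then 3 divides the index [O_{ℚ(θ)} : ℤ[θ]] if and only if (a mod 9, b mod 9) lies in the set {(0,1),(0,8),(3,2),(3,5),(6,2),(6,5)}. -/

import Mathlib

open Polynomial NumberField

/-- The index of the order `ℤ[θ]` in the ring of integers of `K`. -/
noncomputable def indexZTheta {K : Type*} [Field K] [NumberField K]
    (θ : NumberField.RingOfIntegers K) : ℕ :=
  (Algebra.adjoin ℤ ({θ} : Set (NumberField.RingOfIntegers K))).toSubring.toAddSubgroup.index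

theorem aux_C3 : (C (3 : ℤ) : ℤ[X]) = 3 := map_ofNat C 3

/-- Every element of `ℤ[X]/(3, X²+b)` satisfies `y⁹ = y`. -/
theorem aux_pow_nine {T : Type*} [CommRing T] (φ : ℤ[X] →+* T) (b : ℤ) (hb : ¬ (3 : ℤ) ∣ b)
    (h3 : (3 : T) = 0) (hg : φ (X ^ 2 + C b) = 0) (p : ℤ[X]) : φ p ^ 9 = φ p := by
  have h3' : ∀ n : ℤ, (3 : ℤ) ∣ n → φ (C n) = 0 := by
    rintro n ⟨m, rfl⟩
    rw [C_mul, map_mul]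
    have : φ (C 3) = 3 := by rw [aux_C3, map_ofNat]
    rw [this, h3, zero_mul]
  have hc : ∀ n : ℤ, φ (C n) ^ 9 = φ (C n) := by
    intro n
    have : (3 : ℤ) ∣ n ^ 9 - n := by
      have : ∀ z : ZMod 3, z ^ 9 - z = 0 := by decide
      have := this n
      exact (ZMod.intCast_zmod_eq_zero_iff_dvd _ 3).1 (by push_cast; exact_mod_cast this)
    have := h3' _ this
    rw [C_sub, C_pow, map_sub, map_pow] at this
    exact sub_eq_zero.1 this
  have hx : φ X ^ 9 = φ X := by
    have h2 : φ X ^ 2 = - φ (C b) := by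
      rw [map_add, map_pow] at hg
      exact eq_neg_of_add_eq_zero_left hg
    have hb4 : φ (C b) ^ 4 = 1 := by
      have : (3 : ℤ) ∣ b ^ 4 - 1 := by
        have key : ∀ z : ZMod 3, z ≠ 0 → z ^ 4 - 1 = 0 := by decide
        have := key b (fun h => hb ((ZMod.intCast_zmod_eq_zero_iff_dvd _ 3).1 h))
        exact (ZMod.intCast_zmod_eq_zero_iff_dvd _ 3).1 (by push_cast; exact_mod_cast this)
      have := h3' _ this
      rw [C_sub, C_pow, map_sub, map_pow, C_1, map_one] at this
      exact sub_eq_zero.1 this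
    calc φ X ^ 9 = (φ X ^ 2) ^ 4 * φ X := by ring
      _ = φ X := by rw [h2, neg_pow, hb4]; ring
  have cube : ∀ x y : T, (x + y) ^ 3 = x ^ 3 + y ^ 3 := by
    intro x y
    linear_combination (x ^ 2 * y + x * y ^ 2) * h3
  have nine : ∀ x y : T, (x + y) ^ 9 = x ^ 9 + y ^ 9 := by
    intro x y
    calc (x + y) ^ 9 = ((x + y) ^ 3) ^ 3 := by ring
      _ = x ^ 9 + y ^ 9 := by rw [cube, cube]; ring
  induction p using Polynomial.induction_on' with
  | add p q hp hq => rw [map_add, nine, hp, hq]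
  | monomial n c =>
    rw [← C_mul_X_pow_eq_monomial, map_mul, map_pow, mul_pow, hc, ← pow_mul, mul_comm n 9, pow_mul,
      hx]

theorem aux_reduced {T : Type*} [CommRing T] (y : T) (h9 : y ^ 9 = y) (n : ℕ) (hn : y ^ n = 0) :
    y = 0 := by
  have : ∀ k : ℕ, y ^ (9 ^ k) = y := by
    intro k
    induction k with
    | zero => simp
    | succ k ih => rw [pow_succ, pow_mul, ih, h9]
  rw [← this n]
  exact pow_eq_zero_of_le (Nat.lt_pow_self (by norm_num)).le hn

/-- In `ℤ[X]`, if `3 ∣ (X²+b) p` then `3 ∣ p`. -/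
theorem aux_cancel (b : ℤ) (p : ℤ[X]) (h : C 3 ∣ (X ^ 2 + C b) * p) : C 3 ∣ p := by
  have hp : Prime (C (3 : ℤ)) := Polynomial.prime_C_iff.2 Int.prime_three
  rcases hp.dvd_or_dvd h with h | h
  · exfalso
    rw [Polynomial.C_dvd_iff_dvd_coeff] at h
    have := h 2
    rw [coeff_add, coeff_X_pow, coeff_C] at this
    norm_num at this
  · exact h

theorem aux_cond (a b A B : ℤ) (hb : ¬ (3 : ℤ) ∣ b) (hA : a = 3 * A) (hB : b - b ^ 3 = 3 * B) :
    (3 : ℤ) ∣ B ^ 2 + b * A ^ 2 ↔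
      ((a : ZMod 9), (b : ZMod 9)) ∈
        ({(0, 1), (0, 8), (3, 2), (3, 5), (6, 2), (6, 5)} : Set (ZMod 9 × ZMod 9)) := by
  have e1 : (3 : ℤ) ∣ B ^ 2 + b * A ^ 2 ↔ (((b - b ^ 3) * (b - b ^ 3) + b * a * a : ℤ) : ZMod 27) = 0 := by
    rw [ZMod.intCast_zmod_eq_zero_iff_dvd, hA, hB]
    constructor
    · rintro ⟨c, hc⟩
      exact ⟨c, by push_cast; linear_combination 9 * hc⟩
    · rintro ⟨c, hc⟩
      exact ⟨c, by push_cast at hc; linarith⟩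
  have e2 : (a : ZMod 9) = ZMod.castHom (show 9 ∣ 27 by norm_num) (ZMod 9) (a : ZMod 27) := by simp
  have e3 : (b : ZMod 9) = ZMod.castHom (show 9 ∣ 27 by norm_num) (ZMod 9) (b : ZMod 27) := by simp
  have h9b : (9 : ZMod 27) * b ≠ 0 := by
    intro h
    apply hb
    have : ((9 * b : ℤ) : ZMod 27) = 0 := by exact_mod_cast h
    rw [ZMod.intCast_zmod_eq_zero_iff_dvd] at this
    obtain ⟨c, hc⟩ := this
    exact ⟨c, by push_cast at hc; linarith⟩
  have h9a : (9 : ZMod 27) * a = 0 := by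
    have : ((9 * a : ℤ) : ZMod 27) = 0 := by
      rw [ZMod.intCast_zmod_eq_zero_iff_dvd]
      exact ⟨A, by rw [hA]; push_cast; ring⟩
    exact_mod_cast this
  rw [e1, e2, e3]
  push_cast
  generalize (a : ZMod 27) = x at *
  generalize (b : ZMod 27) = y at *
  simp only [Set.mem_insert_iff, Set.mem_singleton_iff, Prod.mk.injEq]
  clear e1 e2 e3
  revert x y
  decide +kernel

section main

variable {K : Type*} [Field K] [NumberField K]

theorem aux_dvd (f : ℤ[X]) (hm : f.Monic)
    (hirr : Irreducible (f.map (Int.castRingHom ℚ))) (θ : 𝓞 K)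
    (hroot : aeval θ f = 0) (p : ℤ[X]) (hp : aeval θ p = 0) : f ∣ p := by
  have conv : ∀ q : ℤ[X], aeval θ q = 0 → aeval (θ : K) (q.map (Int.castRingHom ℚ)) = 0 := by
    intro q hq
    have h1 : aeval (θ : K) (q.map (algebraMap ℤ ℚ)) = aeval (θ : K) q := aeval_map_algebraMap ℚ _ _
    have h2 : aeval (algebraMap (𝓞 K) K θ) q = algebraMap (𝓞 K) K (aeval θ q) :=
      aeval_algebraMap_apply K θ q
    have h3 : aeval (θ : K) q = 0 := by
      rw [hq, map_zero] at h2
      exact h2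
    rw [← h3, ← h1]; rfl
  have h1 := minpoly.eq_of_irreducible_of_monic hirr (conv f hroot) (hm.map _)
  have h2 := minpoly.dvd ℚ (θ : K) (conv p hp)
  rw [← h1] at h2
  exact (Polynomial.map_dvd_map _ (RingHom.injective_int _) hm).1 h2

theorem aux_step (a b A B : ℤ) (hb : ¬ (3 : ℤ) ∣ b) (hA : a = 3 * A) (hB : b - b ^ 3 = 3 * B)
    (hc : ¬ (3 : ℤ) ∣ B ^ 2 + b * A ^ 2) (f : ℤ[X]) (hf : f = X ^ 6 + C a * X + C b) (θ : 𝓞 K)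
    (hdvd : ∀ p : ℤ[X], aeval θ p = 0 → f ∣ p) (hroot : aeval θ f = 0)
    (α : 𝓞 K) (h k : ℤ[X]) (hh : 3 * α = aeval θ h) (hk : aeval θ (X ^ 2 + C b) * α = aeval θ k) :
    ∃ r : ℤ[X], α = aeval θ r := by
  set G : ℤ[X] := X ^ 2 + C b with hG
  set F : ℤ[X] := -C b * X ^ 2 * G + C A * X + C B with hF
  have hfG : f = G ^ 3 + C 3 * F := by
    have hA' : (C a : ℤ[X]) = C 3 * C A := by rw [hA, C_mul]
    have hB' : (C b : ℤ[X]) - C b ^ 3 = C 3 * C B := by rw [← C_mul, ← hB]; simp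
    have h3 := aux_C3
    rw [hf, hF, hG]
    linear_combination X * hA' + hB' + C b * X ^ 2 * (X ^ 2 + C b) * h3
  have t3 : aeval θ (C 3 : ℤ[X]) = 3 := by rw [aux_C3, map_ofNat]
  have three : (3 : 𝓞 K) ≠ 0 := by norm_num
  have gc : aeval θ G ^ 3 = - 3 * aeval θ F := by
    rw [hfG, map_add, map_pow, map_mul, t3] at hroot
    linear_combination hroot
  obtain ⟨l, hl⟩ := hdvd (G * h - C 3 * k) (by
    rw [map_sub, map_mul, map_mul, t3, ← hh, ← hk]; ring)
  obtain ⟨r, hr⟩ := aux_cancel b (h - G ^ 2 * l) (by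
    refine ⟨k + F * l, ?_⟩
    rw [hfG] at hl
    rw [← hG]
    linear_combination hl)
  set β := α - aeval θ r with hβ
  have hβ3 : 3 * β = aeval θ G ^ 2 * aeval θ l := by
    have := congrArg (aeval θ) hr
    rw [map_sub, map_mul, map_mul, map_pow, t3, ← hh] at this
    rw [hβ]; linear_combination this
  have hgβ : aeval θ G * β = aeval θ (-(F * l)) := by
    apply mul_left_cancel₀ three
    rw [map_neg, map_mul]
    linear_combination aeval θ G * hβ3 + aeval θ l * gc
  -- integrality of β
  obtain ⟨q, hqm, hq⟩ := (RingOfIntegers.isIntegral β : IsIntegral ℤ β)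
  set n := q.natDegree with hn
  set E : ℤ[X] := ∑ i ∈ Finset.range (n + 1), C (q.coeff i) * (-(F * l)) ^ i * G ^ (n - i) with hE
  have hE0 : aeval θ E = 0 := by
    have : aeval θ E = aeval θ G ^ n * eval₂ (algebraMap ℤ (𝓞 K)) β q := by
      rw [hE, map_sum, eval₂_eq_sum_range, Finset.mul_sum]
      refine Finset.sum_congr rfl fun i hi => ?_
      have hi' : i ≤ n := Nat.lt_succ_iff.1 (Finset.mem_range.1 hi)
      rw [map_mul, map_mul, map_pow, map_pow, ← hgβ, aeval_C, mul_pow]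
      have hpw : aeval θ G ^ n = aeval θ G ^ (n - i) * aeval θ G ^ i := by
        rw [← pow_add, Nat.sub_add_cancel hi']
      rw [hpw]
      ring
    rw [this, hq, mul_zero]
  obtain ⟨w, hw⟩ := hdvd E hE0
  set J : Ideal ℤ[X] := Ideal.span {C 3, G} with hJ
  let φ := Ideal.Quotient.mk J
  have φ3 : φ (C 3) = 0 := Ideal.Quotient.eq_zero_iff_mem.2 (Ideal.subset_span (by simp))
  have φG : φ G = 0 := Ideal.Quotient.eq_zero_iff_mem.2 (Ideal.subset_span (by simp))
  have φ3' : (3 : ℤ[X] ⧸ J) = 0 := by rw [← φ3, aux_C3, map_ofNat]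
  have φf : φ f = 0 := by rw [hfG, map_add, map_pow, map_mul, φ3, φG]; simp
  have hpow : φ (-(F * l)) ^ n = 0 := by
    have h1 : φ E = 0 := by rw [hw, map_mul, φf, zero_mul]
    rw [hE, map_sum, Finset.sum_range_succ, Finset.sum_eq_zero] at h1
    · have hlc : q.coeff n = 1 := hqm
      simpa [hlc] using h1
    · intro i hi
      have : n - i ≠ 0 := by have := Finset.mem_range.1 hi; omega
      rw [map_mul, map_pow, φG, zero_pow this, mul_zero]
  have hz := aux_reduced _ (aux_pow_nine φ b hb φ3' φG _) n hpow
  have hcl : φ (C (B ^ 2 + b * A ^ 2)) * φ l = 0 := by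
    rw [← map_mul]
    have e : C (B ^ 2 + b * A ^ 2) * l = (-(C B - C A * X)) * (-(F * l))
        + G * (l * (C b * X ^ 2 * (C B - C A * X) + C A ^ 2)) := by
      rw [hF, hG]; simp only [C_add, C_mul, C_pow]; ring
    rw [e, map_add, map_mul, map_mul, hz, φG]; ring
  have hl0 : φ l = 0 := by
    obtain ⟨u, v, huv⟩ := (Int.prime_three.coprime_iff_not_dvd.2 hc)
    have : φ (C (u * 3 + v * (B ^ 2 + b * A ^ 2))) = 1 := by rw [huv]; simp
    rw [C_add, C_mul, C_mul, map_add, map_mul, map_mul, φ3] at this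
    calc φ l = 1 * φ l := by ring
      _ = φ (C v) * (φ (C (B ^ 2 + b * A ^ 2)) * φ l) := by rw [← this]; ring
      _ = 0 := by rw [hcl, mul_zero]
  obtain ⟨s, t, hst⟩ := Ideal.mem_span_pair.1 (Ideal.Quotient.eq_zero_iff_mem.1 hl0)
  refine ⟨r + (G ^ 2 * s - F * t), ?_⟩
  have : β = aeval θ (G ^ 2 * s - F * t) := by
    apply mul_left_cancel₀ three
    rw [hβ3, ← hst]
    simp only [map_add, map_sub, map_mul, map_pow, t3]
    linear_combination aeval θ t * gc
  rw [map_add, ← this, hβ]; ring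

theorem aux_construct (a b A B : ℤ) (hA : a = 3 * A)
    (hB : b - b ^ 3 = 3 * B)
    (hc : (3 : ℤ) ∣ B ^ 2 + b * A ^ 2) (f : ℤ[X]) (hf : f = X ^ 6 + C a * X + C b) (θ : 𝓞 K)
    (hdvd : ∀ p : ℤ[X], aeval θ p = 0 → f ∣ p) (hroot : aeval θ f = 0) :
    ∃ α : 𝓞 K, (∃ h : ℤ[X], 3 * α = aeval θ h) ∧ ¬ ∃ r : ℤ[X], α = aeval θ r := by
  set G : ℤ[X] := X ^ 2 + C b with hG
  set F : ℤ[X] := -C b * X ^ 2 * G + C A * X + C B with hF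
  have hfG : f = G ^ 3 + C 3 * F := by
    have hA' : (C a : ℤ[X]) = C 3 * C A := by rw [hA, C_mul]
    have hB' : (C b : ℤ[X]) - C b ^ 3 = C 3 * C B := by rw [← C_mul, ← hB]; simp
    have h3 := aux_C3
    rw [hf, hF, hG]
    linear_combination X * hA' + hB' + C b * X ^ 2 * (X ^ 2 + C b) * h3
  have t3 : aeval θ (C 3 : ℤ[X]) = 3 := by rw [aux_C3, map_ofNat]
  have gc : aeval θ G ^ 3 = - 3 * aeval θ F := by
    rw [hfG, map_add, map_pow, map_mul, t3] at hroot
    linear_combination hroot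
  -- the multiplier m
  obtain ⟨c, d, s, t, hcd, hm⟩ : ∃ (c d : ℤ) (s t : ℤ[X]), ¬ ((3 : ℤ) ∣ c ∧ (3 : ℤ) ∣ d) ∧
      F * (C c * X + C d) = C 3 * s + G * t := by
    by_cases hAB : (3 : ℤ) ∣ A ∧ (3 : ℤ) ∣ B
    · obtain ⟨⟨A', rfl⟩, ⟨B', rfl⟩⟩ := hAB
      refine ⟨0, 1, C A' * X + C B', -C b * X ^ 2, by norm_num, ?_⟩
      rw [hF]; simp only [C_mul, C_0, C_1]; ring
    · obtain ⟨e, he⟩ := hc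
      refine ⟨-A, B, C e, -C b * X ^ 2 * (C B - C A * X) - C A ^ 2, by rwa [dvd_neg], ?_⟩
      rw [← C_mul, ← he, hF, hG]; simp only [C_add, C_mul, C_pow, C_neg]; ring
  set m : ℤ[X] := C c * X + C d with hmdef
  let x : ℤ[X] → K := fun p => algebraMap (𝓞 K) K (aeval θ p)
  have x3 : x (C 3) = 3 := by
    change algebraMap (𝓞 K) K (aeval θ (C 3)) = 3
    rw [t3, map_ofNat]
  have hx3 : algebraMap (𝓞 K) K 3 = 3 := map_ofNat _ 3
  have hx3' : aeval θ (3 : ℤ[X]) = 3 := map_ofNat _ 3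
  have hint : IsIntegral ℤ (x (G ^ 2 * m) / 3) := by
    have : IsIntegral (𝓞 K) (x (G ^ 2 * m) / 3) := by
      refine ⟨X ^ 2 + C (aeval θ t) * X + C (aeval θ (G * m * s)), by monicity!, ?_⟩
      have gc' : x G ^ 3 = -3 * x F := by
        have := congrArg (algebraMap (𝓞 K) K) gc
        simpa [x, hx3, hx3'] using this
      have hm' : x F * x m = 3 * x s + x G * x t := by
        have := congrArg x hm
        simpa [x, hx3, hx3'] using this
      have e1 : x (G ^ 2 * m) = x G ^ 2 * x m := by simp [x]
      have e2 : x (G * m * s) = x G * x m * x s := by simp [x]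
      simp only [eval₂_add, eval₂_mul, eval₂_pow, eval₂_X, eval₂_C]
      change _ + x t * _ + x (G * m * s) = 0
      rw [e1, e2]
      linear_combination x G * x m ^ 2 / 9 * gc' - x G * x m / 3 * hm'
    exact isIntegral_trans _ this
  obtain ⟨α, hα⟩ : ∃ α : 𝓞 K, algebraMap (𝓞 K) K α = x (G ^ 2 * m) / 3 :=
    ⟨⟨x (G ^ 2 * m) / 3, hint⟩, rfl⟩
  refine ⟨α, ⟨G ^ 2 * m, ?_⟩, ?_⟩
  · apply RingOfIntegers.ext
    change algebraMap (𝓞 K) K (3 * _) = x (G ^ 2 * m)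
    rw [map_mul (algebraMap (𝓞 K) K)]
    rw [hα, map_ofNat]; field_simp
  · rintro ⟨r, hr⟩
    have h1 : x (G ^ 2 * m) / 3 = x r := by
      rw [← hα, hr]
    have h2 : aeval θ (G ^ 2 * m - C 3 * r) = 0 := by
      apply RingOfIntegers.ext
      change algebraMap (𝓞 K) K _ = algebraMap (𝓞 K) K _
      rw [map_sub, map_sub, map_zero]
      change x (G ^ 2 * m) - x (C 3 * r) = 0
      have e1 : x (C 3 * r) = 3 * x r := by simp [x, hx3, hx3']
      rw [e1, ← h1]; field_simp; ring
    obtain ⟨l, hl⟩ := hdvd _ h2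
    rw [hfG] at hl
    have h3 : C 3 ∣ m - G * l := by
      refine aux_cancel b _ (aux_cancel b _ ⟨r + F * l, ?_⟩)
      rw [← hG]; linear_combination hl
    -- reduce mod 3
    have h4 : (m.map (Int.castRingHom (ZMod 3))) =
        G.map (Int.castRingHom (ZMod 3)) * l.map (Int.castRingHom (ZMod 3)) := by
      obtain ⟨e, he⟩ := h3
      have := congrArg (Polynomial.map (Int.castRingHom (ZMod 3))) he
      rw [Polynomial.map_sub, Polynomial.map_mul, Polynomial.map_mul, Polynomial.map_C] at this
      have z : (Int.castRingHom (ZMod 3)) 3 = 0 := by decide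
      rw [z, C_0, zero_mul] at this
      exact sub_eq_zero.1 this
    have hGm : (G.map (Int.castRingHom (ZMod 3))).Monic := by
      apply Monic.map; rw [hG]; monicity!
    have hGd : (G.map (Int.castRingHom (ZMod 3))).degree = 2 := by
      rw [Monic.degree_map (by rw [hG]; monicity!), hG]; compute_degree!
    have h5 : m.map (Int.castRingHom (ZMod 3)) = 0 := by
      by_contra hne
      have hlt : (m.map (Int.castRingHom (ZMod 3))).degree < (G.map (Int.castRingHom (ZMod 3))).degree := by
        rw [hGd]
        refine lt_of_le_of_lt (degree_map_le) ?_
        rw [hmdef]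
        exact lt_of_le_of_lt degree_linear_le (by norm_num)
      exact hGm.not_dvd_of_degree_lt hne hlt ⟨_, h4⟩
    apply hcd
    constructor
    · have := congrArg (fun p => coeff p 1) h5
      simp [hmdef, coeff_C, -eq_intCast, -map_intCast] at this
      exact (ZMod.intCast_zmod_eq_zero_iff_dvd _ 3).1 this
    · have := congrArg (fun p => coeff p 0) h5
      simp [hmdef] at this
      exact (ZMod.intCast_zmod_eq_zero_iff_dvd _ 3).1 this

theorem aux_torsion (θ : 𝓞 K) (hgen : Algebra.adjoin ℚ ({(θ : K)} : Set K) = ⊤) (α : 𝓞 K) :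
    ∃ n : ℤ, n ≠ 0 ∧ ∃ r : ℤ[X], n • α = aeval θ r := by
  have h : (α : K) ∈ Algebra.adjoin ℚ ({(θ : K)} : Set K) := by rw [hgen]; trivial
  rw [Algebra.adjoin_singleton_eq_range_aeval] at h
  obtain ⟨p, hp⟩ := h
  obtain ⟨n, hn, hnp⟩ := IsLocalization.integerNormalization_spec (nonZeroDivisors ℤ) p
  refine ⟨n, nonZeroDivisors.ne_zero hn, IsLocalization.integerNormalization (nonZeroDivisors ℤ) p, ?_⟩
  apply RingOfIntegers.ext
  have h2 : aeval (algebraMap (𝓞 K) K θ) (IsLocalization.integerNormalization (nonZeroDivisors ℤ) p)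
      = algebraMap (𝓞 K) K (aeval θ (IsLocalization.integerNormalization (nonZeroDivisors ℤ) p)) :=
    aeval_algebraMap_apply K θ _
  refine Eq.trans ?_ h2
  rw [← aeval_map_algebraMap ℚ, hnp, map_zsmul]
  change algebraMap (𝓞 K) K _ = _
  rw [map_zsmul]
  congr 1
  exact hp.symm

theorem aux_index (θ : 𝓞 K) (hgen : Algebra.adjoin ℚ ({(θ : K)} : Set K) = ⊤) :
    3 ∣ indexZTheta θ ↔
      ∃ α : 𝓞 K, (∃ h : ℤ[X], 3 * α = aeval θ h) ∧ ¬ ∃ r : ℤ[X], α = aeval θ r := by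
  set N : AddSubgroup (𝓞 K) :=
    (Algebra.adjoin ℤ ({θ} : Set (𝓞 K))).toSubring.toAddSubgroup with hN
  have memN : ∀ x : 𝓞 K, x ∈ N ↔ ∃ r : ℤ[X], x = aeval θ r := by
    intro x
    change x ∈ Algebra.adjoin ℤ ({θ} : Set (𝓞 K)) ↔ _
    rw [Algebra.adjoin_singleton_eq_range_aeval]
    exact ⟨fun ⟨r, hr⟩ => ⟨r, hr.symm⟩, fun ⟨r, hr⟩ => ⟨r, hr.symm⟩⟩
  have hidx : indexZTheta θ = Nat.card (𝓞 K ⧸ N) := rfl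
  rw [hidx]
  have : Fact (Nat.Prime 3) := ⟨Nat.prime_three⟩
  constructor
  · intro h
    have hfin : Finite (𝓞 K ⧸ N) := by
      have : Module.Finite ℤ (𝓞 K ⧸ N) :=
        Module.Finite.of_surjective (QuotientAddGroup.mk' N).toIntLinearMap
          (QuotientAddGroup.mk'_surjective N)
      apply Module.finite_of_fg_torsion
      intro x
      obtain ⟨α, rfl⟩ := QuotientAddGroup.mk'_surjective N x
      obtain ⟨n, hn, r, hr⟩ := aux_torsion θ hgen α
      refine ⟨⟨n, mem_nonZeroDivisors_of_ne_zero hn⟩, ?_⟩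
      change n • (QuotientAddGroup.mk' N α) = 0
      rw [← map_zsmul]
      exact (QuotientAddGroup.eq_zero_iff _).2 ((memN _).2 ⟨r, hr⟩)
    obtain ⟨x, hx⟩ := exists_prime_addOrderOf_dvd_card' 3 h
    obtain ⟨α, rfl⟩ := QuotientAddGroup.mk'_surjective N x
    refine ⟨α, ?_, ?_⟩
    · rw [← memN]
      have h3 := addOrderOf_nsmul_eq_zero (QuotientAddGroup.mk' N α)
      rw [hx, ← map_nsmul] at h3
      have := (QuotientAddGroup.eq_zero_iff _).1 h3
      simpa using this
    · rw [← memN]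
      intro hα
      have : QuotientAddGroup.mk' N α = 0 := (QuotientAddGroup.eq_zero_iff _).2 hα
      rw [this] at hx
      simp at hx
  · rintro ⟨α, h1, h2⟩
    rw [← memN] at h1 h2
    have : addOrderOf (QuotientAddGroup.mk' N α) = 3 := by
      apply addOrderOf_eq_prime
      · rw [← map_nsmul]
        exact (QuotientAddGroup.eq_zero_iff _).2 (by simpa using h1)
      · intro h
        exact h2 ((QuotientAddGroup.eq_zero_iff _).1 h)
    rw [← this]
    exact addOrderOf_dvd_natCard _

end main

theorem stmt10 (a b : ℤ) (ha : (3 : ℤ) ∣ a) (hb : ¬ (3 : ℤ) ∣ b)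
    (f : ℤ[X]) (hf : f = X ^ 6 + C a * X + C b)
    (hirr : Irreducible (f.map (Int.castRingHom ℚ)))
    (K : Type*) [Field K] [NumberField K] (θ : NumberField.RingOfIntegers K)
    (hroot : Polynomial.aeval θ f = 0)
    (hgen : Algebra.adjoin ℚ ({(θ : K)} : Set K) = ⊤) :
    3 ∣ indexZTheta θ ↔
      ((a : ZMod 9), (b : ZMod 9)) ∈
        ({(0, 1), (0, 8), (3, 2), (3, 5), (6, 2), (6, 5)} : Set (ZMod 9 × ZMod 9)) := by
  obtain ⟨A, hA⟩ := ha
  obtain ⟨B, hB⟩ : (3 : ℤ) ∣ b - b ^ 3 := by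
    have key : ∀ z : ZMod 3, z - z ^ 3 = 0 := by decide
    have := key b
    exact (ZMod.intCast_zmod_eq_zero_iff_dvd _ 3).1 (by push_cast; exact_mod_cast this)
  have hm : f.Monic := by rw [hf]; monicity!
  have hdvd := aux_dvd f hm hirr θ hroot
  rw [aux_index θ hgen, ← aux_cond a b A B hb hA hB]
  constructor
  · rintro ⟨α, ⟨h, hh⟩, hα⟩
    by_contra hc
    apply hα
    have step := aux_step a b A B hb hA hB hc f hf θ hdvd hroot
    set G : ℤ[X] := X ^ 2 + C b with hG
    have t3 : aeval θ (C 3 : ℤ[X]) = 3 := by rw [aux_C3, map_ofNat]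
    obtain ⟨k, hk⟩ : ∃ k : ℤ[X], aeval θ G ^ 3 * α = aeval θ k := by
      refine ⟨-((-C b * X ^ 2 * G + C A * X + C B) * h), ?_⟩
      have hfG : f = G ^ 3 + C 3 * (-C b * X ^ 2 * G + C A * X + C B) := by
        have hA' : (C a : ℤ[X]) = C 3 * C A := by rw [hA, C_mul]
        have hB' : (C b : ℤ[X]) - C b ^ 3 = C 3 * C B := by rw [← C_mul, ← hB]; simp
        have h3 := aux_C3
        rw [hf, hG]
        linear_combination X * hA' + hB' + C b * X ^ 2 * (X ^ 2 + C b) * h3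
      rw [hfG, map_add, map_pow, map_mul, t3] at hroot
      rw [map_neg, map_mul, ← hh]
      linear_combination α * hroot
    obtain ⟨k2, hk2⟩ := step (aeval θ G ^ 2 * α) (G ^ 2 * h) k
      (by rw [map_mul, map_pow, ← hh]; ring) (by rw [← hk]; ring)
    obtain ⟨k1, hk1⟩ := step (aeval θ G * α) (G * h) k2
      (by rw [map_mul, ← hh]; ring) (by rw [← hk2]; ring)
    exact step α h k1 hh hk1
  · intro hc
    exact aux_construct a b A B hA hB hc f hf θ hdvd hroot
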